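/- The set of 10-element cliques in C with weights in {1,2} whose weight-2 graph is a disjoint union of three triangles and one isolated vertex has exactly 2,150,400 elements, and the stabilizer in W of any such clique has order 324. -/

import Mathlib

/-- The intersection pairing on `ℤ⁹`, the Picard lattice of a del Pezzo surface of degree 1. -/
def B (v w : Fin 9 → ℤ) : ℤ := v 0 * w 0 - ∑ i : Fin 8, v i.succ * w i.succ

/-- The canonical class `K = (-3, -1, …, -1)`. -/
def Kcl : Fin 9 → ℤ := fun i => if i = 0 then -3 else -1

/-- A vector is an exceptional class if `B(v,v) = -1` and `B(v,K) = -1`. -/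
def IsExc (v : Fin 9 → ℤ) : Prop := B v v = -1 ∧ B v Kcl = -1

/-- The type of exceptional classes (the set `C`). -/
abbrev Exc : Type := {v : Fin 9 → ℤ // IsExc v}

/-- The pairing on exceptional classes. -/
def Bx (x y : Exc) : ℤ := B x.1 y.1

/-- `S` is a clique with weights in `M` if `B(x,y) ∈ M` for all distinct `x, y ∈ S`. -/
def IsClique (M : Set ℤ) (S : Finset Exc) : Prop :=
  ∀ x ∈ S, ∀ y ∈ S, x ≠ y → Bx x y ∈ M

/-- A bijection of `C` preserving the pairing `B`: an element of the Weyl group `W`. -/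
def PreservesB (g : Exc ≃ Exc) : Prop := ∀ x y : Exc, Bx (g x) (g y) = Bx x y

/-- Two finite subsets of `C` lie in the same orbit of `W`. -/
def SameOrbit (S T : Finset Exc) : Prop :=
  ∃ g : Exc ≃ Exc, PreservesB g ∧ S.image g = T

/-- The weight-2 graph of the clique `S` is (isomorphic to) the graph on `Fin 10` in which
`i ≠ j` are adjacent iff `p i j`. -/
def HasWeight2Graph (p : Fin 10 → Fin 10 → Prop) (S : Finset Exc) : Prop :=
  ∃ σ : Fin 10 ≃ {x // x ∈ S}, ∀ i j : Fin 10, i ≠ j → (Bx (σ i).1 (σ j).1 = 2 ↔ p i j)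

/-- Block structure of a disjoint union of three triangles (`{0,1,2}`, `{3,4,5}`, `{6,7,8}`)
and one isolated vertex (`{9}`). -/
def blockTTTV (i : Fin 10) : ℕ :=
  if i.1 < 3 then 0 else if i.1 < 6 then 1 else if i.1 < 9 then 2 else 3


/-- Shifted natural coordinates of an exceptional class: `(a, b_1 + 1, ..., b_8 + 1)`. -/
@[ext] structure V where
  a : ℕ
  b1 : ℕ
  b2 : ℕ
  b3 : ℕ
  b4 : ℕ
  b5 : ℕ
  b6 : ℕ
  b7 : ℕ
  b8 : ℕ
deriving DecidableEq


def L240 : List V := [⟨0,0,1,1,1,1,1,1,1⟩, ⟨0,1,0,1,1,1,1,1,1⟩, ⟨0,1,1,0,1,1,1,1,1⟩, ⟨0,1,1,1,0,1,1,1,1⟩,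
  ⟨0,1,1,1,1,0,1,1,1⟩, ⟨0,1,1,1,1,1,0,1,1⟩, ⟨0,1,1,1,1,1,1,0,1⟩, ⟨0,1,1,1,1,1,1,1,0⟩,
  ⟨1,1,1,1,1,1,1,2,2⟩, ⟨1,1,1,1,1,1,2,1,2⟩, ⟨1,1,1,1,1,1,2,2,1⟩, ⟨1,1,1,1,1,2,1,1,2⟩,
  ⟨1,1,1,1,1,2,1,2,1⟩, ⟨1,1,1,1,1,2,2,1,1⟩, ⟨1,1,1,1,2,1,1,1,2⟩, ⟨1,1,1,1,2,1,1,2,1⟩,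
  ⟨1,1,1,1,2,1,2,1,1⟩, ⟨1,1,1,1,2,2,1,1,1⟩, ⟨1,1,1,2,1,1,1,1,2⟩, ⟨1,1,1,2,1,1,1,2,1⟩,
  ⟨1,1,1,2,1,1,2,1,1⟩, ⟨1,1,1,2,1,2,1,1,1⟩, ⟨1,1,1,2,2,1,1,1,1⟩, ⟨1,1,2,1,1,1,1,1,2⟩,
  ⟨1,1,2,1,1,1,1,2,1⟩, ⟨1,1,2,1,1,1,2,1,1⟩, ⟨1,1,2,1,1,2,1,1,1⟩, ⟨1,1,2,1,2,1,1,1,1⟩,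
  ⟨1,1,2,2,1,1,1,1,1⟩, ⟨1,2,1,1,1,1,1,1,2⟩, ⟨1,2,1,1,1,1,1,2,1⟩, ⟨1,2,1,1,1,1,2,1,1⟩,
  ⟨1,2,1,1,1,2,1,1,1⟩, ⟨1,2,1,1,2,1,1,1,1⟩, ⟨1,2,1,2,1,1,1,1,1⟩, ⟨1,2,2,1,1,1,1,1,1⟩,
  ⟨2,1,1,1,2,2,2,2,2⟩, ⟨2,1,1,2,1,2,2,2,2⟩, ⟨2,1,1,2,2,1,2,2,2⟩, ⟨2,1,1,2,2,2,1,2,2⟩,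
  ⟨2,1,1,2,2,2,2,1,2⟩, ⟨2,1,1,2,2,2,2,2,1⟩, ⟨2,1,2,1,1,2,2,2,2⟩, ⟨2,1,2,1,2,1,2,2,2⟩,
  ⟨2,1,2,1,2,2,1,2,2⟩, ⟨2,1,2,1,2,2,2,1,2⟩, ⟨2,1,2,1,2,2,2,2,1⟩, ⟨2,1,2,2,1,1,2,2,2⟩,
  ⟨2,1,2,2,1,2,1,2,2⟩, ⟨2,1,2,2,1,2,2,1,2⟩, ⟨2,1,2,2,1,2,2,2,1⟩, ⟨2,1,2,2,2,1,1,2,2⟩,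
  ⟨2,1,2,2,2,1,2,1,2⟩, ⟨2,1,2,2,2,1,2,2,1⟩, ⟨2,1,2,2,2,2,1,1,2⟩, ⟨2,1,2,2,2,2,1,2,1⟩,
  ⟨2,1,2,2,2,2,2,1,1⟩, ⟨2,2,1,1,1,2,2,2,2⟩, ⟨2,2,1,1,2,1,2,2,2⟩, ⟨2,2,1,1,2,2,1,2,2⟩,
  ⟨2,2,1,1,2,2,2,1,2⟩, ⟨2,2,1,1,2,2,2,2,1⟩, ⟨2,2,1,2,1,1,2,2,2⟩, ⟨2,2,1,2,1,2,1,2,2⟩,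
  ⟨2,2,1,2,1,2,2,1,2⟩, ⟨2,2,1,2,1,2,2,2,1⟩, ⟨2,2,1,2,2,1,1,2,2⟩, ⟨2,2,1,2,2,1,2,1,2⟩,
  ⟨2,2,1,2,2,1,2,2,1⟩, ⟨2,2,1,2,2,2,1,1,2⟩, ⟨2,2,1,2,2,2,1,2,1⟩, ⟨2,2,1,2,2,2,2,1,1⟩,
  ⟨2,2,2,1,1,1,2,2,2⟩, ⟨2,2,2,1,1,2,1,2,2⟩, ⟨2,2,2,1,1,2,2,1,2⟩, ⟨2,2,2,1,1,2,2,2,1⟩,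
  ⟨2,2,2,1,2,1,1,2,2⟩, ⟨2,2,2,1,2,1,2,1,2⟩, ⟨2,2,2,1,2,1,2,2,1⟩, ⟨2,2,2,1,2,2,1,1,2⟩,
  ⟨2,2,2,1,2,2,1,2,1⟩, ⟨2,2,2,1,2,2,2,1,1⟩, ⟨2,2,2,2,1,1,1,2,2⟩, ⟨2,2,2,2,1,1,2,1,2⟩,
  ⟨2,2,2,2,1,1,2,2,1⟩, ⟨2,2,2,2,1,2,1,1,2⟩, ⟨2,2,2,2,1,2,1,2,1⟩, ⟨2,2,2,2,1,2,2,1,1⟩,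
  ⟨2,2,2,2,2,1,1,1,2⟩, ⟨2,2,2,2,2,1,1,2,1⟩, ⟨2,2,2,2,2,1,2,1,1⟩, ⟨2,2,2,2,2,2,1,1,1⟩,
  ⟨3,1,2,2,2,2,2,2,3⟩, ⟨3,1,2,2,2,2,2,3,2⟩, ⟨3,1,2,2,2,2,3,2,2⟩, ⟨3,1,2,2,2,3,2,2,2⟩,
  ⟨3,1,2,2,3,2,2,2,2⟩, ⟨3,1,2,3,2,2,2,2,2⟩, ⟨3,1,3,2,2,2,2,2,2⟩, ⟨3,2,1,2,2,2,2,2,3⟩,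
  ⟨3,2,1,2,2,2,2,3,2⟩, ⟨3,2,1,2,2,2,3,2,2⟩, ⟨3,2,1,2,2,3,2,2,2⟩, ⟨3,2,1,2,3,2,2,2,2⟩,
  ⟨3,2,1,3,2,2,2,2,2⟩, ⟨3,2,2,1,2,2,2,2,3⟩, ⟨3,2,2,1,2,2,2,3,2⟩, ⟨3,2,2,1,2,2,3,2,2⟩,
  ⟨3,2,2,1,2,3,2,2,2⟩, ⟨3,2,2,1,3,2,2,2,2⟩, ⟨3,2,2,2,1,2,2,2,3⟩, ⟨3,2,2,2,1,2,2,3,2⟩,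
  ⟨3,2,2,2,1,2,3,2,2⟩, ⟨3,2,2,2,1,3,2,2,2⟩, ⟨3,2,2,2,2,1,2,2,3⟩, ⟨3,2,2,2,2,1,2,3,2⟩,
  ⟨3,2,2,2,2,1,3,2,2⟩, ⟨3,2,2,2,2,2,1,2,3⟩, ⟨3,2,2,2,2,2,1,3,2⟩, ⟨3,2,2,2,2,2,2,1,3⟩,
  ⟨3,2,2,2,2,2,2,3,1⟩, ⟨3,2,2,2,2,2,3,1,2⟩, ⟨3,2,2,2,2,2,3,2,1⟩, ⟨3,2,2,2,2,3,1,2,2⟩,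
  ⟨3,2,2,2,2,3,2,1,2⟩, ⟨3,2,2,2,2,3,2,2,1⟩, ⟨3,2,2,2,3,1,2,2,2⟩, ⟨3,2,2,2,3,2,1,2,2⟩,
  ⟨3,2,2,2,3,2,2,1,2⟩, ⟨3,2,2,2,3,2,2,2,1⟩, ⟨3,2,2,3,1,2,2,2,2⟩, ⟨3,2,2,3,2,1,2,2,2⟩,
  ⟨3,2,2,3,2,2,1,2,2⟩, ⟨3,2,2,3,2,2,2,1,2⟩, ⟨3,2,2,3,2,2,2,2,1⟩, ⟨3,2,3,1,2,2,2,2,2⟩,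
  ⟨3,2,3,2,1,2,2,2,2⟩, ⟨3,2,3,2,2,1,2,2,2⟩, ⟨3,2,3,2,2,2,1,2,2⟩, ⟨3,2,3,2,2,2,2,1,2⟩,
  ⟨3,2,3,2,2,2,2,2,1⟩, ⟨3,3,1,2,2,2,2,2,2⟩, ⟨3,3,2,1,2,2,2,2,2⟩, ⟨3,3,2,2,1,2,2,2,2⟩,
  ⟨3,3,2,2,2,1,2,2,2⟩, ⟨3,3,2,2,2,2,1,2,2⟩, ⟨3,3,2,2,2,2,2,1,2⟩, ⟨3,3,2,2,2,2,2,2,1⟩,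
  ⟨4,2,2,2,2,2,3,3,3⟩, ⟨4,2,2,2,2,3,2,3,3⟩, ⟨4,2,2,2,2,3,3,2,3⟩, ⟨4,2,2,2,2,3,3,3,2⟩,
  ⟨4,2,2,2,3,2,2,3,3⟩, ⟨4,2,2,2,3,2,3,2,3⟩, ⟨4,2,2,2,3,2,3,3,2⟩, ⟨4,2,2,2,3,3,2,2,3⟩,
  ⟨4,2,2,2,3,3,2,3,2⟩, ⟨4,2,2,2,3,3,3,2,2⟩, ⟨4,2,2,3,2,2,2,3,3⟩, ⟨4,2,2,3,2,2,3,2,3⟩,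
  ⟨4,2,2,3,2,2,3,3,2⟩, ⟨4,2,2,3,2,3,2,2,3⟩, ⟨4,2,2,3,2,3,2,3,2⟩, ⟨4,2,2,3,2,3,3,2,2⟩,
  ⟨4,2,2,3,3,2,2,2,3⟩, ⟨4,2,2,3,3,2,2,3,2⟩, ⟨4,2,2,3,3,2,3,2,2⟩, ⟨4,2,2,3,3,3,2,2,2⟩,
  ⟨4,2,3,2,2,2,2,3,3⟩, ⟨4,2,3,2,2,2,3,2,3⟩, ⟨4,2,3,2,2,2,3,3,2⟩, ⟨4,2,3,2,2,3,2,2,3⟩,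
  ⟨4,2,3,2,2,3,2,3,2⟩, ⟨4,2,3,2,2,3,3,2,2⟩, ⟨4,2,3,2,3,2,2,2,3⟩, ⟨4,2,3,2,3,2,2,3,2⟩,
  ⟨4,2,3,2,3,2,3,2,2⟩, ⟨4,2,3,2,3,3,2,2,2⟩, ⟨4,2,3,3,2,2,2,2,3⟩, ⟨4,2,3,3,2,2,2,3,2⟩,
  ⟨4,2,3,3,2,2,3,2,2⟩, ⟨4,2,3,3,2,3,2,2,2⟩, ⟨4,2,3,3,3,2,2,2,2⟩, ⟨4,3,2,2,2,2,2,3,3⟩,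
  ⟨4,3,2,2,2,2,3,2,3⟩, ⟨4,3,2,2,2,2,3,3,2⟩, ⟨4,3,2,2,2,3,2,2,3⟩, ⟨4,3,2,2,2,3,2,3,2⟩,
  ⟨4,3,2,2,2,3,3,2,2⟩, ⟨4,3,2,2,3,2,2,2,3⟩, ⟨4,3,2,2,3,2,2,3,2⟩, ⟨4,3,2,2,3,2,3,2,2⟩,
  ⟨4,3,2,2,3,3,2,2,2⟩, ⟨4,3,2,3,2,2,2,2,3⟩, ⟨4,3,2,3,2,2,2,3,2⟩, ⟨4,3,2,3,2,2,3,2,2⟩,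
  ⟨4,3,2,3,2,3,2,2,2⟩, ⟨4,3,2,3,3,2,2,2,2⟩, ⟨4,3,3,2,2,2,2,2,3⟩, ⟨4,3,3,2,2,2,2,3,2⟩,
  ⟨4,3,3,2,2,2,3,2,2⟩, ⟨4,3,3,2,2,3,2,2,2⟩, ⟨4,3,3,2,3,2,2,2,2⟩, ⟨4,3,3,3,2,2,2,2,2⟩,
  ⟨5,2,2,3,3,3,3,3,3⟩, ⟨5,2,3,2,3,3,3,3,3⟩, ⟨5,2,3,3,2,3,3,3,3⟩, ⟨5,2,3,3,3,2,3,3,3⟩,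
  ⟨5,2,3,3,3,3,2,3,3⟩, ⟨5,2,3,3,3,3,3,2,3⟩, ⟨5,2,3,3,3,3,3,3,2⟩, ⟨5,3,2,2,3,3,3,3,3⟩,
  ⟨5,3,2,3,2,3,3,3,3⟩, ⟨5,3,2,3,3,2,3,3,3⟩, ⟨5,3,2,3,3,3,2,3,3⟩, ⟨5,3,2,3,3,3,3,2,3⟩,
  ⟨5,3,2,3,3,3,3,3,2⟩, ⟨5,3,3,2,2,3,3,3,3⟩, ⟨5,3,3,2,3,2,3,3,3⟩, ⟨5,3,3,2,3,3,2,3,3⟩,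
  ⟨5,3,3,2,3,3,3,2,3⟩, ⟨5,3,3,2,3,3,3,3,2⟩, ⟨5,3,3,3,2,2,3,3,3⟩, ⟨5,3,3,3,2,3,2,3,3⟩,
  ⟨5,3,3,3,2,3,3,2,3⟩, ⟨5,3,3,3,2,3,3,3,2⟩, ⟨5,3,3,3,3,2,2,3,3⟩, ⟨5,3,3,3,3,2,3,2,3⟩,
  ⟨5,3,3,3,3,2,3,3,2⟩, ⟨5,3,3,3,3,3,2,2,3⟩, ⟨5,3,3,3,3,3,2,3,2⟩, ⟨5,3,3,3,3,3,3,2,2⟩,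
  ⟨6,3,3,3,3,3,3,3,4⟩, ⟨6,3,3,3,3,3,3,4,3⟩, ⟨6,3,3,3,3,3,4,3,3⟩, ⟨6,3,3,3,3,4,3,3,3⟩,
  ⟨6,3,3,3,4,3,3,3,3⟩, ⟨6,3,3,4,3,3,3,3,3⟩, ⟨6,3,4,3,3,3,3,3,3⟩, ⟨6,4,3,3,3,3,3,3,3⟩]

def tIdx : List ℕ := [0, 141, 35, 148, 2, 3, 5, 6]
def sIdx : List ℕ := [0, 141, 238, 35, 148, 167, 108, 126, 130, 117]
def oIdx : List ℕ := [108, 109, 113, 117, 118, 119, 120, 121, 122, 126, 130, 131]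
def zIdx : List (List ℕ) := [[1, 98, 2, 18, 41, 3, 14, 4, 11, 5, 9, 6, 7, 8, 10, 12, 13, 15, 16, 17, 19, 20, 21, 22, 23, 24, 25, 26, 27, 28, 36, 37, 38, 39, 40, 42, 43, 44, 45, 46, 47, 48, 49, 50, 51, 52, 53, 54, 55, 56, 92, 93, 94, 95, 96, 97, 141], [142, 193, 216, 198], [72, 91, 73, 77, 84, 74, 75, 76, 78, 79, 80, 81, 82, 83, 85, 86, 87, 88, 89, 90, 148], [149, 153, 160, 155], [], [], [], []]

def rowsX : List (List ℕ × List ℕ) := [([0, 141, 35, 148, 2, 3, 5, 6], [0, 141, 238, 35, 148, 167, 108, 126, 130, 117]),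
  ([0, 141, 35, 148, 2, 3, 5, 7], [0, 141, 238, 35, 148, 167, 108, 126, 130, 118]),
  ([0, 141, 35, 148, 2, 3, 6, 5], [0, 141, 238, 35, 148, 167, 108, 126, 130, 119]),
  ([0, 141, 35, 148, 2, 3, 6, 7], [0, 141, 238, 35, 148, 167, 108, 126, 130, 121]),
  ([0, 141, 35, 148, 2, 3, 7, 5], [0, 141, 238, 35, 148, 167, 108, 126, 130, 120]),
  ([0, 141, 35, 148, 2, 3, 7, 6], [0, 141, 238, 35, 148, 167, 108, 126, 130, 122]),
  ([0, 141, 35, 148, 2, 4, 5, 6], [0, 141, 238, 35, 148, 167, 109, 113, 131, 117]),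
  ([0, 141, 35, 148, 2, 4, 5, 7], [0, 141, 238, 35, 148, 167, 109, 113, 131, 118]),
  ([0, 141, 35, 148, 2, 4, 6, 5], [0, 141, 238, 35, 148, 167, 109, 113, 131, 119]),
  ([0, 141, 35, 148, 2, 4, 6, 7], [0, 141, 238, 35, 148, 167, 109, 113, 131, 121]),
  ([0, 141, 35, 148, 2, 4, 7, 5], [0, 141, 238, 35, 148, 167, 109, 113, 131, 120]),
  ([0, 141, 35, 148, 2, 4, 7, 6], [0, 141, 238, 35, 148, 167, 109, 113, 131, 122]),
  ([0, 141, 148, 35, 8, 9, 36, 37], [0, 141, 238, 148, 35, 167, 117, 120, 121, 108]),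
  ([0, 141, 148, 35, 8, 9, 36, 38], [0, 141, 238, 148, 35, 167, 117, 120, 121, 109]),
  ([0, 141, 148, 35, 8, 9, 37, 36], [0, 141, 238, 148, 35, 167, 117, 120, 121, 113]),
  ([0, 141, 148, 35, 8, 9, 37, 38], [0, 141, 238, 148, 35, 167, 117, 120, 121, 130]),
  ([0, 141, 148, 35, 8, 9, 38, 36], [0, 141, 238, 148, 35, 167, 117, 120, 121, 126]),
  ([0, 141, 148, 35, 8, 9, 38, 37], [0, 141, 238, 148, 35, 167, 117, 120, 121, 131]),
  ([0, 141, 148, 35, 8, 10, 36, 37], [0, 141, 238, 148, 35, 167, 118, 119, 122, 108]),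
  ([0, 141, 148, 35, 8, 10, 36, 38], [0, 141, 238, 148, 35, 167, 118, 119, 122, 109]),
  ([0, 141, 148, 35, 8, 10, 37, 36], [0, 141, 238, 148, 35, 167, 118, 119, 122, 113]),
  ([0, 141, 148, 35, 8, 10, 37, 38], [0, 141, 238, 148, 35, 167, 118, 119, 122, 130]),
  ([0, 141, 148, 35, 8, 10, 38, 36], [0, 141, 238, 148, 35, 167, 118, 119, 122, 126]),
  ([0, 141, 148, 35, 8, 10, 38, 37], [0, 141, 238, 148, 35, 167, 118, 119, 122, 131])]

def rowsS : List (List ℕ × List ℕ) := [([0, 141, 35, 148, 2, 3, 5, 6], [0, 141, 238, 35, 148, 167, 108, 126, 130, 117]),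
  ([141, 0, 35, 167, 32, 33, 29, 30], [141, 0, 238, 35, 167, 148, 108, 130, 126, 117]),
  ([238, 0, 35, 148, 135, 136, 138, 139], [238, 0, 141, 35, 148, 167, 108, 126, 130, 117]),
  ([35, 148, 0, 141, 2, 3, 23, 24], [35, 148, 167, 0, 141, 238, 108, 126, 130, 117]),
  ([148, 35, 0, 238, 42, 43, 8, 9], [148, 35, 167, 0, 238, 141, 108, 130, 126, 117]),
  ([167, 35, 0, 141, 17, 21, 54, 55], [167, 35, 148, 0, 141, 238, 108, 126, 130, 117]),
  ([108, 126, 0, 141, 2, 17, 44, 45], [108, 126, 130, 0, 141, 238, 35, 148, 167, 117]),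
  ([126, 108, 0, 238, 27, 43, 14, 15], [126, 108, 130, 0, 238, 141, 35, 167, 148, 117]),
  ([130, 108, 0, 141, 3, 21, 48, 49], [130, 108, 126, 0, 141, 238, 35, 148, 167, 117]),
  ([0, 141, 35, 148, 2, 3, 5, 6], [0, 141, 238, 35, 148, 167, 108, 126, 130, 117]),
  ([0, 238, 35, 167, 26, 27, 23, 24], [0, 238, 141, 35, 167, 148, 108, 130, 126, 117]),
  ([0, 141, 35, 148, 2, 3, 5, 6], [0, 141, 238, 35, 148, 167, 108, 126, 130, 117]),
  ([0, 141, 148, 167, 36, 37, 8, 9], [0, 141, 238, 148, 167, 35, 108, 126, 130, 117]),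
  ([0, 141, 167, 35, 17, 21, 39, 40], [0, 141, 238, 167, 35, 148, 108, 126, 130, 117]),
  ([0, 141, 108, 126, 2, 17, 11, 12], [0, 141, 238, 108, 126, 130, 35, 148, 167, 117]),
  ([0, 141, 126, 130, 4, 22, 14, 15], [0, 141, 238, 126, 130, 108, 35, 148, 167, 117]),
  ([0, 141, 130, 108, 3, 21, 18, 19], [0, 141, 238, 130, 108, 126, 35, 148, 167, 117]),
  ([0, 141, 35, 148, 2, 3, 5, 6], [0, 141, 238, 35, 148, 167, 108, 126, 130, 117]),
  ([0, 141, 35, 148, 4, 2, 5, 6], [0, 141, 238, 35, 148, 167, 126, 130, 108, 117]),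
  ([0, 141, 35, 148, 3, 4, 5, 6], [0, 141, 238, 35, 148, 167, 130, 108, 126, 117])]


/-- `B x y + 1 = n`. -/
def eqB (x y : V) (n : ℕ) : Bool :=
  match x, y with
  | ⟨a, b1, b2, b3, b4, b5, b6, b7, b8⟩, ⟨c, d1, d2, d3, d4, d5, d6, d7, d8⟩ =>
    Nat.beq (a * c + 3 * a + 3 * c + 7)
      (b1 * d1 + b2 * d2 + b3 * d3 + b4 * d4 + b5 * d5 + b6 * d6 + b7 * d7 + b8 * d8 + n)

/-- `B x y = B z w` -/
def sameB (x y z w : V) : Bool :=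
  match x, y, z, w with
  | ⟨a, b1, b2, b3, b4, b5, b6, b7, b8⟩, ⟨c, d1, d2, d3, d4, d5, d6, d7, d8⟩,
    ⟨a', b1', b2', b3', b4', b5', b6', b7', b8'⟩, ⟨c', d1', d2', d3', d4', d5', d6', d7', d8'⟩ =>
    Nat.beq ((a * c + 3 * a + 3 * c) +
      (b1' * d1' + b2' * d2' + b3' * d3' + b4' * d4' + b5' * d5' + b6' * d6' + b7' * d7' + b8' * d8'))
      ((a' * c' + 3 * a' + 3 * c') +
      (b1 * d1 + b2 * d2 + b3 * d3 + b4 * d4 + b5 * d5 + b6 * d6 + b7 * d7 + b8 * d8))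

def V.fn (x : V) : Fin 9 → ℤ := ![x.a, (x.b1 : ℤ) - 1, (x.b2 : ℤ) - 1, (x.b3 : ℤ) - 1,
  (x.b4 : ℤ) - 1, (x.b5 : ℤ) - 1, (x.b6 : ℤ) - 1, (x.b7 : ℤ) - 1, (x.b8 : ℤ) - 1]

def toV (x : Exc) : V := ⟨(x.1 0).toNat, (x.1 1 + 1).toNat, (x.1 2 + 1).toNat, (x.1 3 + 1).toNat,
  (x.1 4 + 1).toNat, (x.1 5 + 1).toNat, (x.1 6 + 1).toNat, (x.1 7 + 1).toNat, (x.1 8 + 1).toNat⟩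

theorem B_eq (v w : Fin 9 → ℤ) : B v w = v 0 * w 0 - (v 1 * w 1 + v 2 * w 2 + v 3 * w 3 +
    v 4 * w 4 + v 5 * w 5 + v 6 * w 6 + v 7 * w 7 + v 8 * w 8) := by
  simp only [B, Fin.sum_univ_eight]; rfl

theorem BK_eq (v : Fin 9 → ℤ) : B v Kcl = -3 * v 0 + (v 1 + v 2 + v 3 +
    v 4 + v 5 + v 6 + v 7 + v 8) := by
  rw [B_eq]
  have h0 : Kcl 0 = -3 := rfl
  have h1 : Kcl 1 = -1 := rfl
  have h2 : Kcl 2 = -1 := rfl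
  have h3 : Kcl 3 = -1 := rfl
  have h4 : Kcl 4 = -1 := rfl
  have h5 : Kcl 5 = -1 := rfl
  have h6 : Kcl 6 = -1 := rfl
  have h7 : Kcl 7 = -1 := rfl
  have h8 : Kcl 8 = -1 := rfl
  rw [h0, h1, h2, h3, h4, h5, h6, h7, h8]; ring

theorem c7 (x1 x2 x3 x4 x5 x6 x7 : ℤ) : (x1 + x2 + x3 + x4 + x5 + x6 + x7)^2 ≤
      7 * (x1*x1 + x2*x2 + x3*x3 + x4*x4 + x5*x5 + x6*x6 + x7*x7) := by
  linarith [sq_nonneg (x1-x2), sq_nonneg (x1-x3), sq_nonneg (x1-x4), sq_nonneg (x1-x5),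
      sq_nonneg (x1-x6), sq_nonneg (x1-x7), sq_nonneg (x2-x3), sq_nonneg (x2-x4),
      sq_nonneg (x2-x5), sq_nonneg (x2-x6), sq_nonneg (x2-x7), sq_nonneg (x3-x4),
      sq_nonneg (x3-x5), sq_nonneg (x3-x6), sq_nonneg (x3-x7), sq_nonneg (x4-x5),
      sq_nonneg (x4-x6), sq_nonneg (x4-x7), sq_nonneg (x5-x6), sq_nonneg (x5-x7),
      sq_nonneg (x6-x7)]

theorem key7 (a b x1 x2 x3 x4 x5 x6 x7 : ℤ)
    (h : b + x1 + x2 + x3 + x4 + x5 + x6 + x7 = 3 * a - 1)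
    (q : b*b + x1*x1 + x2*x2 + x3*x3 + x4*x4 + x5*x5 + x6*x6 + x7*x7 = a*a + 1) :
    (3 * a - 1 - b)^2 ≤ 7 * (a*a + 1 - b*b) := by
  have key := c7 x1 x2 x3 x4 x5 x6 x7
  have e1 : x1 + x2 + x3 + x4 + x5 + x6 + x7 = 3 * a - 1 - b := by linarith
  have e2 : x1*x1 + x2*x2 + x3*x3 + x4*x4 + x5*x5 + x6*x6 + x7*x7 = a*a + 1 - b*b := by linarith
  rwa [e1, e2] at key

theorem bnd (a b x1 x2 x3 x4 x5 x6 x7 : ℤ) (h : b + x1 + x2 + x3 + x4 + x5 + x6 + x7 = 3 * a - 1)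
    (q : b*b + x1*x1 + x2*x2 + x3*x3 + x4*x4 + x5*x5 + x6*x6 + x7*x7 = a*a + 1) :
    -1 ≤ b ∧ b ≤ 3 := by
  have key := key7 a b x1 x2 x3 x4 x5 x6 x7 h q
  clear h q
  have k2 : (b - 3) * (b + 1) ≤ 0 := by nlinarith [sq_nonneg (2 * a - 3 - 3 * b)]
  constructor <;> by_contra hh <;> nlinarith

theorem bnda (a x0 x1 x2 x3 x4 x5 x6 x7 : ℤ)
    (h : x0 + x1 + x2 + x3 + x4 + x5 + x6 + x7 = 3 * a - 1)
    (q : x0*x0 + x1*x1 + x2*x2 + x3*x3 + x4*x4 + x5*x5 + x6*x6 + x7*x7 = a*a + 1) :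
    0 ≤ a ∧ a ≤ 6 := by
  have h0 := bnd a x0 x1 x2 x3 x4 x5 x6 x7 h q
  have key := key7 a x0 x1 x2 x3 x4 x5 x6 x7 h q
  clear h q
  obtain ⟨h3, h4⟩ := h0
  constructor
  · interval_cases x0 <;> nlinarith
  · interval_cases x0 <;> nlinarith

theorem exc_sum (x : Exc) : x.1 1 + x.1 2 + x.1 3 + x.1 4 + x.1 5 + x.1 6 + x.1 7 + x.1 8
    = 3 * x.1 0 - 1 := by
  have h := x.2.2
  rw [BK_eq] at h
  linarith

theorem exc_sq (x : Exc) : x.1 1 * x.1 1 + x.1 2 * x.1 2 + x.1 3 * x.1 3 + x.1 4 * x.1 4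
    + x.1 5 * x.1 5 + x.1 6 * x.1 6 + x.1 7 * x.1 7 + x.1 8 * x.1 8 = x.1 0 * x.1 0 + 1 := by
  have h := x.2.1
  rw [B_eq] at h
  linarith

theorem exc_bnd (x : Exc) : (0 ≤ x.1 0 ∧ x.1 0 ≤ 6) ∧ (-1 ≤ x.1 1 ∧ x.1 1 ≤ 3) ∧
    (-1 ≤ x.1 2 ∧ x.1 2 ≤ 3) ∧ (-1 ≤ x.1 3 ∧ x.1 3 ≤ 3) ∧ (-1 ≤ x.1 4 ∧ x.1 4 ≤ 3) ∧
    (-1 ≤ x.1 5 ∧ x.1 5 ≤ 3) ∧ (-1 ≤ x.1 6 ∧ x.1 6 ≤ 3) ∧ (-1 ≤ x.1 7 ∧ x.1 7 ≤ 3) ∧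
    (-1 ≤ x.1 8 ∧ x.1 8 ≤ 3) := by
  have h := exc_sum x
  have q := exc_sq x
  generalize x.1 0 = a at *
  generalize x.1 1 = x1 at *
  generalize x.1 2 = x2 at *
  generalize x.1 3 = x3 at *
  generalize x.1 4 = x4 at *
  generalize x.1 5 = x5 at *
  generalize x.1 6 = x6 at *
  generalize x.1 7 = x7 at *
  generalize x.1 8 = x8 at *
  refine ⟨bnda a x1 x2 x3 x4 x5 x6 x7 x8 h q, bnd a x1 x2 x3 x4 x5 x6 x7 x8 h q,
    bnd a x2 x1 x3 x4 x5 x6 x7 x8 ?_ ?_, bnd a x3 x2 x1 x4 x5 x6 x7 x8 ?_ ?_,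
    bnd a x4 x2 x3 x1 x5 x6 x7 x8 ?_ ?_, bnd a x5 x2 x3 x4 x1 x6 x7 x8 ?_ ?_,
    bnd a x6 x2 x3 x4 x5 x1 x7 x8 ?_ ?_, bnd a x7 x2 x3 x4 x5 x6 x1 x8 ?_ ?_,
    bnd a x8 x2 x3 x4 x5 x6 x7 x1 ?_ ?_⟩ <;> linarith

theorem fn_toV (x : Exc) : (toV x).fn = x.1 := by
  obtain ⟨h0, h1, h2, h3, h4, h5, h6, h7, h8⟩ := exc_bnd x
  funext i
  fin_cases i <;> simp [toV, V.fn] <;> omega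

theorem toV_inj {x y : Exc} (h : toV x = toV y) : x = y :=
  Subtype.ext (by rw [← fn_toV x, ← fn_toV y, h])

theorem fn_B (v w : V) : B v.fn w.fn = v.a * w.a - (((v.b1 : ℤ) - 1) * ((w.b1 : ℤ) - 1)
   + ((v.b2 : ℤ) - 1) * ((w.b2 : ℤ) - 1) + ((v.b3 : ℤ) - 1) * ((w.b3 : ℤ) - 1)
   + ((v.b4 : ℤ) - 1) * ((w.b4 : ℤ) - 1) + ((v.b5 : ℤ) - 1) * ((w.b5 : ℤ) - 1)
   + ((v.b6 : ℤ) - 1) * ((w.b6 : ℤ) - 1) + ((v.b7 : ℤ) - 1) * ((w.b7 : ℤ) - 1)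
   + ((v.b8 : ℤ) - 1) * ((w.b8 : ℤ) - 1)) := by
  rw [B_eq]; rfl

theorem fn_sum (v : V) (h : IsExc v.fn) : (v.b1 : ℤ) + v.b2 + v.b3 + v.b4 + v.b5 + v.b6 + v.b7
    + v.b8 = 3 * v.a + 7 := by
  have h := h.2
  rw [BK_eq] at h
  have : -3 * (v.a : ℤ) + (((v.b1 : ℤ) - 1) + ((v.b2 : ℤ) - 1) + ((v.b3 : ℤ) - 1) +
    ((v.b4 : ℤ) - 1) + ((v.b5 : ℤ) - 1) + ((v.b6 : ℤ) - 1) + ((v.b7 : ℤ) - 1)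
    + ((v.b8 : ℤ) - 1)) = -1 := h
  linarith

theorem toV_exc (x : Exc) : IsExc (toV x).fn := by rw [fn_toV]; exact x.2

theorem Bx_toV (x y : Exc) : Bx x y = ((toV x).a * (toV y).a + 3 * (toV x).a + 3 * (toV y).a + 6 : ℤ)
    - ((toV x).b1 * (toV y).b1 + (toV x).b2 * (toV y).b2 + (toV x).b3 * (toV y).b3
    + (toV x).b4 * (toV y).b4 + (toV x).b5 * (toV y).b5 + (toV x).b6 * (toV y).b6
    + (toV x).b7 * (toV y).b7 + (toV x).b8 * (toV y).b8) := by
  have h1 := fn_sum _ (toV_exc x)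
  have h2 := fn_sum _ (toV_exc y)
  have : Bx x y = B (toV x).fn (toV y).fn := by rw [fn_toV, fn_toV]; rfl
  rw [this, fn_B]
  linear_combination h1 + h2

theorem eqB_iff (x y : Exc) (n : ℕ) : eqB (toV x) (toV y) n = true ↔ Bx x y = (n : ℤ) - 1 := by
  rw [Bx_toV]
  simp only [eqB, Nat.beq_eq]
  zify
  constructor <;> intro h <;> linarith

theorem sameB_iff (x y z w : Exc) :
    sameB (toV x) (toV y) (toV z) (toV w) = true ↔ Bx x y = Bx z w := by
  rw [Bx_toV, Bx_toV]
  simp only [sameB, Nat.beq_eq]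
  zify
  constructor <;> intro h <;> linarith

/-- enumeration of lists of `k` digits in `0..4` with sum `s` and sum of squares `q` -/
def gen : ℕ → ℕ → ℕ → List (List ℕ)
  | 0, s, q => if s = 0 ∧ q = 0 then [[]] else []
  | k + 1, s, q => if s * s ≤ (k + 1) * q then
      [0, 1, 2, 3, 4].flatMap (fun n => if n ≤ s ∧ n * n ≤ q then
        (gen k (s - n) (q - n * n)).map (List.cons n) else []) else []

theorem sum_sq_le (l : List ℕ) : l.sum * l.sum ≤ l.length * (l.map (fun n => n * n)).sum := by
  induction l with
  | nil => simp
  | cons n l ih =>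
    simp only [List.sum_cons, List.length_cons, List.map_cons]
    have : 2 * (n * l.sum) ≤ l.length * (n * n) + (l.map (fun n => n * n)).sum := by
      clear ih
      induction l with
      | nil => simp
      | cons m l ih =>
        simp only [List.sum_cons, List.length_cons, List.map_cons]
        have : 2 * (n * m) ≤ n * n + m * m := by
          zify; nlinarith [sq_nonneg ((n : ℤ) - m)]
        nlinarith
    nlinarith

theorem mem_gen (l : List ℕ) (h : ∀ n ∈ l, n ≤ 4) :
    l ∈ gen l.length l.sum (l.map (fun n => n * n)).sum := by
  induction l with
  | nil => simp [gen]
  | cons n l ih =>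
    have hs := sum_sq_le (n :: l)
    simp only [List.length_cons] at hs ⊢
    rw [gen, if_pos hs, List.mem_flatMap]
    refine ⟨n, ?_, ?_⟩
    · have := h n (by simp)
      interval_cases n <;> simp
    · simp only [List.sum_cons, List.map_cons]
      rw [if_pos ⟨by omega, by omega⟩, Nat.add_sub_cancel_left, Nat.add_sub_cancel_left]
      exact List.mem_map_of_mem (ih (fun m hm => h m (by simp [hm])))

def V.tail (v : V) : List ℕ := [v.b1, v.b2, v.b3, v.b4, v.b5, v.b6, v.b7, v.b8]

theorem gen_eq : (List.range 7).flatMap (fun a => (gen 8 (3 * a + 7) (a * a + 6 * a + 7)).map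
    (List.cons a)) = L240.map (fun v => v.a :: v.tail) := by decide +kernel

theorem mem_L (x : Exc) : toV x ∈ L240 := by
  have hb := exc_bnd x
  have h1 := fn_sum _ (toV_exc x)
  have h2 := (toV_exc x).1
  rw [fn_B] at h2
  have hx : (toV x).a < 7 ∧ ∀ n ∈ (toV x).tail, n ≤ 4 := by
    obtain ⟨h0, h1, h2, h3, h4, h5, h6, h7, h8⟩ := hb
    simp only [toV, V.tail, List.mem_cons, List.not_mem_nil, or_false, forall_eq_or_imp, forall_eq]
    omega
  generalize toV x = v at *
  have hm := mem_gen v.tail hx.2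
  have e1 : v.tail.sum = 3 * v.a + 7 := by
    simp only [V.tail, List.sum_cons, List.sum_nil]; omega
  have e2 : (v.tail.map (fun n => n * n)).sum = v.a * v.a + 6 * v.a + 7 := by
    simp only [V.tail, List.map_cons, List.map_nil, List.sum_cons, List.sum_nil]
    zify
    linear_combination 2 * h1 - h2
  rw [e1, e2] at hm
  have : v.a :: v.tail ∈ L240.map (fun v => v.a :: v.tail) := by
    rw [← gen_eq, List.mem_flatMap]
    exact ⟨v.a, List.mem_range.2 hx.1, List.mem_map_of_mem hm⟩
  obtain ⟨w, hw, he⟩ := List.mem_map.1 this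
  have : w = v := by
    simp only [V.tail, List.cons.injEq, and_true] at he
    ext <;> simp [he]
  exact this ▸ hw

def V.code (v : V) : ℕ := v.tail.foldl (fun c n => 10 * c + n) v.a

theorem L_nodup : L240.Nodup := by
  have h : (L240.map V.code).IsChain (· < ·) := by decide +kernel
  rw [List.isChain_iff_pairwise] at h
  exact List.Nodup.of_map V.code (h.imp (fun h => Nat.ne_of_lt h))

theorem exc_iff (v : V) : IsExc v.fn ↔
    (v.b1 + v.b2 + v.b3 + v.b4 + v.b5 + v.b6 + v.b7 + v.b8 = 3 * v.a + 7 ∧ eqB v v 0 = true) := by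
  constructor
  · intro h
    have h1 := fn_sum v h
    refine ⟨by omega, ?_⟩
    have h2 := h.1
    rw [fn_B] at h2
    simp only [eqB, Nat.beq_eq]
    zify
    linear_combination -2 * h1 + h2
  · rintro ⟨h1, h2⟩
    simp only [eqB, Nat.beq_eq] at h2
    zify at h1 h2
    refine ⟨?_, ?_⟩
    · rw [fn_B]; linear_combination 2 * h1 + h2
    · rw [BK_eq]
      have : -3 * (v.a : ℤ) + (((v.b1 : ℤ) - 1) + ((v.b2 : ℤ) - 1) + ((v.b3 : ℤ) - 1) +
        ((v.b4 : ℤ) - 1) + ((v.b5 : ℤ) - 1) + ((v.b6 : ℤ) - 1) + ((v.b7 : ℤ) - 1)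
        + ((v.b8 : ℤ) - 1)) = -1 := by linarith
      exact this

theorem L_exc : ∀ v ∈ L240, IsExc v.fn := by
  have : L240.all (fun v => decide (v.b1 + v.b2 + v.b3 + v.b4 + v.b5 + v.b6 + v.b7 + v.b8
    = 3 * v.a + 7) && eqB v v 0) = true := by decide +kernel
  rw [List.all_eq_true] at this
  intro v hv
  have := this v hv
  rw [Bool.and_eq_true, decide_eq_true_iff] at this
  exact (exc_iff v).2 this

def vv (i : ℕ) : V := L240.getD i ⟨0,0,1,1,1,1,1,1,1⟩

theorem vv_mem (i : ℕ) : vv i ∈ L240 := by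
  unfold vv
  rw [List.getD_eq_getElem?_getD]
  rcases h : L240[i]? with _ | v
  · exact List.mem_cons_self
  · exact List.mem_of_getElem? h

def ex (i : ℕ) : Exc := ⟨(vv i).fn, L_exc _ (vv_mem i)⟩

theorem toV_ex (i : ℕ) : toV (ex i) = vv i := by
  ext <;> simp [toV, ex, V.fn]

theorem exists_ex (x : Exc) : ∃ v ∈ L240, toV x = v := ⟨_, mem_L x, rfl⟩


theorem B_comm (v w : Fin 9 → ℤ) : B v w = B w v := by
  rw [B_eq, B_eq]; ring

theorem B_add_smul (v r w : Fin 9 → ℤ) (c : ℤ) : B (v + c • r) w = B v w + c * B r w := by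
  simp only [B_eq, Pi.add_apply, Pi.smul_apply, smul_eq_mul]; ring

theorem B_sub (v r w : Fin 9 → ℤ) : B (v - r) w = B v w - B r w := by
  simp only [B_eq, Pi.sub_apply]; ring

theorem Bx_comm (x y : Exc) : Bx x y = Bx y x := B_comm _ _

theorem Bx_self (x : Exc) : Bx x x = -1 := x.2.1

theorem B_refl2 (r v w : Fin 9 → ℤ) (hr : B r r = -2) :
    B (v + B v r • r) (w + B w r • r) = B v w := by
  rw [B_add_smul, B_comm v, B_comm r, B_add_smul, B_add_smul, hr, B_comm w v, B_comm r v]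
  ring

/-- the Weyl group -/
def W : Subgroup (Equiv.Perm Exc) where
  carrier := {g | PreservesB g}
  one_mem' := fun _ _ => rfl
  mul_mem' := fun {g h} hg hh x y => by
    rw [Equiv.Perm.mul_apply, Equiv.Perm.mul_apply, hg, hh]
  inv_mem' := fun {g} hg x y => by
    have := hg (g⁻¹ x) (g⁻¹ y)
    simpa using this.symm

theorem W_Bx {g : Equiv.Perm Exc} (hg : g ∈ W) (x y : Exc) : Bx (g x) (g y) = Bx x y := hg x y

theorem exists_refl (x y : Exc) (h : Bx x y = 0) :
    ∃ g ∈ W, g x = y ∧ ∀ z, Bx z x = Bx z y → g z = z := by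
  have hr : B (x.1 - y.1) (x.1 - y.1) = -2 := by
    rw [B_sub, B_comm x.1, B_comm y.1, B_sub, B_sub]
    have h1 := x.2.1
    have h2 := y.2.1
    have h3 : B x.1 y.1 = 0 := h
    rw [B_comm y.1 x.1, h1, h2, h3]; ring
  have hK : B (x.1 - y.1) Kcl = 0 := by
    rw [B_sub, x.2.2, y.2.2]; ring
  set r := x.1 - y.1 with hrd
  let φ : Exc → Exc := fun z => ⟨z.1 + B z.1 r • r, by
    refine ⟨?_, ?_⟩
    · rw [B_refl2 r _ _ hr]; exact z.2.1
    · rw [B_add_smul, hK, z.2.2]; ring⟩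
  have hinv : ∀ z, φ (φ z) = z := by
    intro z
    apply Subtype.ext
    show (z.1 + B z.1 r • r) + B (z.1 + B z.1 r • r) r • r = z.1
    rw [B_add_smul, hr]
    funext i
    simp only [Pi.add_apply, Pi.smul_apply, smul_eq_mul]
    ring
  have hzr : ∀ z : Exc, B z.1 r = Bx z x - Bx z y := by
    intro z
    rw [B_comm, hrd, B_sub, B_comm, B_comm y.1]; rfl
  refine ⟨⟨φ, φ, hinv, hinv⟩, ?_, ?_, ?_⟩
  · intro z w
    exact B_refl2 r _ _ hr
  · apply Subtype.ext
    show x.1 + B x.1 r • r = y.1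
    rw [hzr, h, Bx_self, hrd]
    funext i
    simp only [Pi.add_apply, Pi.smul_apply, Pi.sub_apply, smul_eq_mul]
    ring
  · intro z hz
    apply Subtype.ext
    show z.1 + B z.1 r • r = z.1
    rw [hzr, hz, sub_self, zero_smul, add_zero]

def tn (k : ℕ) : ℕ := tIdx.getD k 0
def sn (k : ℕ) : ℕ := sIdx.getD k 0
def t (k : ℕ) : Exc := ex (tn k)
def s (k : ℕ) : Exc := ex (sn k)

theorem toV_t (k : ℕ) : toV (t k) = vv (tn k) := toV_ex _
theorem toV_s (k : ℕ) : toV (s k) = vv (sn k) := toV_ex _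

def inE (k : ℕ) (v : V) : Bool :=
  (List.range k).all (fun i => sameB v (vv (tn i)) (vv (tn k)) (vv (tn i)))

def DD (k : ℕ) (Z : List ℕ) : ℕ → V → Bool
  | 0, v => eqB v (vv (tn k)) 1 || decide (v = vv (tn k))
  | n + 1, v => DD k Z n v || Z.any (fun z => eqB (vv z) v 1 && inE k (vv z) && DD k Z n (vv z))

theorem inE_iff (k : ℕ) (y : Exc) :
    inE k (toV y) = true ↔ ∀ i < k, Bx y (t i) = Bx (t k) (t i) := by
  simp only [inE, List.all_eq_true, List.mem_range]
  refine forall₂_congr fun i _ => ?_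
  rw [← toV_t, ← toV_t, sameB_iff]

theorem conn_aux (k : ℕ) (Z : List ℕ) (n : ℕ) : ∀ y : Exc, inE k (toV y) = true →
    DD k Z n (toV y) = true → ∃ h ∈ W, (∀ i < k, h (t i) = t i) ∧ h (t k) = y := by
  induction n with
  | zero =>
    intro y hy hd
    rw [inE_iff] at hy
    simp only [DD, Bool.or_eq_true, decide_eq_true_eq] at hd
    rcases hd with hd | hd
    · rw [← toV_t, eqB_iff] at hd
      obtain ⟨g, hg, h1, h2⟩ := exists_refl (t k) y (by rw [Bx_comm, hd]; norm_num)
      exact ⟨g, hg, fun i hi => h2 _ (by rw [Bx_comm, ← hy i hi, Bx_comm]), h1⟩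
    · rw [← toV_t] at hd
      exact ⟨1, W.one_mem, fun _ _ => rfl, (toV_inj hd).symm⟩
  | succ n ih =>
    intro y hy hd
    simp only [DD, Bool.or_eq_true, List.any_eq_true, Bool.and_eq_true] at hd
    rcases hd with hd | ⟨z, -, ⟨h1, h2⟩, h3⟩
    · exact ih y hy hd
    · rw [← toV_ex] at h1 h2 h3
      obtain ⟨h, hW, hf, hz⟩ := ih _ h2 h3
      rw [inE_iff] at hy h2
      rw [eqB_iff] at h1
      obtain ⟨g, hg, g1, g2⟩ := exists_refl (ex z) y (by rw [h1]; norm_num)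
      refine ⟨g * h, W.mul_mem hg hW, fun i hi => ?_, ?_⟩
      · rw [Equiv.Perm.mul_apply, hf i hi]
        exact g2 _ (by rw [Bx_comm, h2 i hi, ← hy i hi, Bx_comm])
      · rw [Equiv.Perm.mul_apply, hz, g1]

theorem conn_check : (List.range 8).all (fun k => L240.all (fun v =>
    !(inE k v) || DD k (zIdx.getD k []) 2 v)) = true := by decide +kernel

theorem conn (k : ℕ) (hk : k < 8) (y : Exc) (hy : ∀ i < k, Bx y (t i) = Bx (t k) (t i)) :
    ∃ h ∈ W, (∀ i < k, h (t i) = t i) ∧ h (t k) = y := by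
  have := conn_check
  rw [List.all_eq_true] at this
  have := this k (List.mem_range.2 hk)
  rw [List.all_eq_true] at this
  have := this _ (mem_L y)
  rw [← inE_iff] at hy
  rw [hy] at this
  exact conn_aux k _ 2 y hy this

theorem app_inv (g : Equiv.Perm Exc) (x : Exc) : g (g⁻¹ x) = x := by simp

theorem transW (T : ℕ → Exc) (k : ℕ) (hk : k ≤ 8)
    (hT : ∀ i < k, ∀ j < i, Bx (T i) (T j) = Bx (t i) (t j)) :
    ∃ g ∈ W, ∀ i < k, g (t i) = T i := by
  induction k with
  | zero => exact ⟨1, W.one_mem, by simp⟩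
  | succ k ih =>
    obtain ⟨g, hg, h1⟩ := ih (by omega) (fun i hi => hT i (by omega))
    obtain ⟨h, hh, h2, h3⟩ := conn k (by omega) (g⁻¹ (T k)) (fun i hi => by
      rw [← hT k (by omega) i hi, ← h1 i hi, ← W_Bx hg, app_inv])
    refine ⟨g * h, W.mul_mem hg hh, fun i hi => ?_⟩
    rw [Equiv.Perm.mul_apply]
    rcases Nat.lt_succ_iff_lt_or_eq.1 hi with hi | rfl
    · rw [h2 i hi, h1 i hi]
    · rw [h3, app_inv]

theorem sep (x y : Exc) (h : ∀ i < 8, Bx x (t i) = Bx y (t i)) : x = y := by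
  have e0 : vv (tn 0) = ⟨0,0,1,1,1,1,1,1,1⟩ := by decide +kernel
  have e1 : vv (tn 1) = ⟨3,3,1,2,2,2,2,2,2⟩ := by decide +kernel
  have e2 : vv (tn 2) = ⟨1,2,2,1,1,1,1,1,1⟩ := by decide +kernel
  have e3 : vv (tn 3) = ⟨4,2,2,2,2,2,3,3,3⟩ := by decide +kernel
  have e4 : vv (tn 4) = ⟨0,1,1,0,1,1,1,1,1⟩ := by decide +kernel
  have e5 : vv (tn 5) = ⟨0,1,1,1,0,1,1,1,1⟩ := by decide +kernel
  have e6 : vv (tn 6) = ⟨0,1,1,1,1,1,0,1,1⟩ := by decide +kernel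
  have e7 : vv (tn 7) = ⟨0,1,1,1,1,1,1,0,1⟩ := by decide +kernel
  have h0 := h 0 (by norm_num)
  have h1 := h 1 (by norm_num)
  have h2 := h 2 (by norm_num)
  have h3 := h 3 (by norm_num)
  have h4 := h 4 (by norm_num)
  have h5 := h 5 (by norm_num)
  have h6 := h 6 (by norm_num)
  have h7 := h 7 (by norm_num)
  have k1 := fn_sum _ (toV_exc x)
  have k2 := fn_sum _ (toV_exc y)
  rw [Bx_toV, Bx_toV, toV_t, e0] at h0
  rw [Bx_toV, Bx_toV, toV_t, e1] at h1
  rw [Bx_toV, Bx_toV, toV_t, e2] at h2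
  rw [Bx_toV, Bx_toV, toV_t, e3] at h3
  rw [Bx_toV, Bx_toV, toV_t, e4] at h4
  rw [Bx_toV, Bx_toV, toV_t, e5] at h5
  rw [Bx_toV, Bx_toV, toV_t, e6] at h6
  rw [Bx_toV, Bx_toV, toV_t, e7] at h7
  apply toV_inj
  generalize toV x = v at *
  generalize toV y = w at *
  push_cast at h0 h1 h2 h3 h4 h5 h6 h7
  ext <;> omega

/-- row check -/
def rowOK (T Y : List ℕ) : Bool :=
  (List.range 8).all (fun i => (List.range i).all (fun j =>
    sameB (vv (T.getD i 0)) (vv (T.getD j 0)) (vv (tn i)) (vv (tn j)))) &&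
  (List.range 10).all (fun j => (List.range 8).all (fun i =>
    sameB (vv (Y.getD j 0)) (vv (T.getD i 0)) (vv (sn j)) (vv (tn i))))

theorem row (T Y : List ℕ) (h : rowOK T Y = true) :
    ∃ g ∈ W, ∀ j < 10, g (s j) = ex (Y.getD j 0) := by
  simp only [rowOK, Bool.and_eq_true, List.all_eq_true, List.mem_range] at h
  obtain ⟨h1, h2⟩ := h
  obtain ⟨g, hg, hT⟩ := transW (fun i => ex (T.getD i 0)) 8 le_rfl (fun i hi j hj => by
    have := h1 i hi j hj
    rwa [← toV_t, ← toV_t, ← toV_ex, ← toV_ex, sameB_iff] at this)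
  refine ⟨g, hg, fun j hj => ?_⟩
  rw [← Equiv.Perm.eq_inv_iff_eq]
  refine sep _ _ (fun i hi => ?_)
  have := h2 j hj i hi
  rw [← toV_t, ← toV_s, ← toV_ex, ← toV_ex, sameB_iff] at this
  rw [← this, ← hT i hi, ← W_Bx hg (g⁻¹ _), app_inv]

theorem rows_check : (rowsX ++ rowsS).all (fun r => rowOK r.1 r.2) = true := by decide +kernel


theorem ncard_toV (p : V → Bool) :
    {y : Exc | p (toV y) = true}.ncard = (L240.filter p).length := by
  have h1 : toV '' {y : Exc | p (toV y) = true} = ((L240.filter p).toFinset : Set V) := by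
    ext v
    simp only [Set.mem_image, Set.mem_ofPred_eq, List.coe_toFinset, List.mem_filter]
    constructor
    · rintro ⟨y, hy, rfl⟩
      exact ⟨mem_L y, hy⟩
    · rintro ⟨hv, hp⟩
      have : toV ⟨v.fn, L_exc v hv⟩ = v := by ext <;> simp [toV, V.fn]
      exact ⟨⟨v.fn, L_exc v hv⟩, by rw [this]; exact hp, this⟩
  rw [← Set.ncard_image_of_injective _ (fun _ _ => toV_inj), h1, Set.ncard_coe_finset,
    List.toFinset_card_of_nodup (L_nodup.filter p)]

theorem finite_Exc : Finite Exc := by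
  have : Function.Injective (fun x : Exc => (⟨toV x, by simpa using mem_L x⟩ : {v // v ∈ L240.toFinset})) := by
    intro x y h
    exact toV_inj (congrArg Subtype.val h)
  exact Finite.of_injective _ this

theorem card_step {α β : Type*} [Group α] [MulAction α β] (G : Subgroup α) (x : β) :
    Nat.card G = {y | ∃ g ∈ G, g • x = y}.ncard *
      Nat.card (G ⊓ MulAction.stabilizer α x : Subgroup α) := by
  have h1 := Subgroup.card_mul_index (MulAction.stabilizer G x)
  rw [MulAction.index_stabilizer] at h1
  have h2 : MulAction.orbit G x = {y | ∃ g ∈ G, g • x = y} := by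
    ext y
    simp only [MulAction.mem_orbit_iff, Set.mem_ofPred_eq]
    exact ⟨fun ⟨g, hg⟩ => ⟨g.1, g.2, hg⟩, fun ⟨g, h, hg⟩ => ⟨⟨g, h⟩, hg⟩⟩
  have h3 : Nat.card (MulAction.stabilizer G x) =
      Nat.card (G ⊓ MulAction.stabilizer α x : Subgroup α) := by
    apply Nat.card_congr
    refine ⟨fun g => ⟨g.1.1, g.1.2, g.2⟩, fun g => ⟨⟨g.1, g.2.1⟩, g.2.2⟩, fun g => rfl, fun g => rfl⟩
  rw [← h1, h2, h3, mul_comm]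

/-- pointwise stabilizer of `t i`, `i < k` -/
def H : ℕ → Subgroup (Equiv.Perm Exc)
  | 0 => W
  | k + 1 => H k ⊓ MulAction.stabilizer (Equiv.Perm Exc) (t k)

theorem mem_H (k : ℕ) (g : Equiv.Perm Exc) : g ∈ H k ↔ g ∈ W ∧ ∀ i < k, g (t i) = t i := by
  induction k with
  | zero => simp [H]
  | succ k ih =>
    rw [H, Subgroup.mem_inf, ih, MulAction.mem_stabilizer_iff, Equiv.Perm.smul_def, and_assoc]
    refine and_congr_right fun _ => ⟨fun ⟨h1, h2⟩ i hi => ?_, fun h => ⟨fun i hi => h i (by omega),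
      h k (by omega)⟩⟩
    rcases Nat.lt_succ_iff_lt_or_eq.1 hi with hi | rfl
    · exact h1 i hi
    · exact h2

theorem H8 : H 8 = ⊥ := by
  rw [Subgroup.eq_bot_iff_forall]
  intro g hg
  rw [mem_H] at hg
  ext1 x
  refine sep _ _ (fun i hi => ?_)
  conv_lhs => rw [← hg.2 i hi]
  exact W_Bx hg.1 _ _

theorem H_step (k : ℕ) (hk : k < 8) :
    Nat.card (H k) = (L240.filter (inE k)).length * Nat.card (H (k + 1)) := by
  rw [card_step (H k) (t k), ← ncard_toV]
  congr 2
  ext y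
  simp only [Set.mem_ofPred_eq, Equiv.Perm.smul_def]
  rw [inE_iff]
  constructor
  · rintro ⟨g, hg, rfl⟩ i hi
    rw [mem_H] at hg
    conv_lhs => rw [← hg.2 i hi]
    exact W_Bx hg.1 _ _
  · intro hy
    obtain ⟨h, h1, h2, h3⟩ := conn k hk y hy
    exact ⟨h, (mem_H _ _).2 ⟨h1, h2⟩, h3⟩

theorem E_card : (List.range 8).map (fun k => (L240.filter (inE k)).length) =
    [240, 56, 72, 20, 3, 2, 3, 2] := by decide +kernel

theorem card_W : Nat.card W = 696729600 := by
  have h := E_card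
  simp only [List.range, List.range.loop, List.map_cons, List.map_nil, List.cons.injEq, and_true] at h
  obtain ⟨h0, h1, h2, h3, h4, h5, h6, h7⟩ := h
  have : W = H 0 := rfl
  rw [this, H_step 0 (by norm_num), H_step 1 (by norm_num), H_step 2 (by norm_num),
    H_step 3 (by norm_num), H_step 4 (by norm_num), H_step 5 (by norm_num), H_step 6 (by norm_num),
    H_step 7 (by norm_num), h0, h1, h2, h3, h4, h5, h6, h7]
  simp only [Nat.reduceAdd]
  rw [H8]
  simp


open scoped Pointwise in
theorem smul_eq_image (g : Equiv.Perm Exc) (S : Finset Exc) : g • S = S.image g := rfl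

/-- exact Gram condition -/
def PP (f : Fin 10 → Exc) : Prop :=
  ∀ i j, i ≠ j → Bx (f i) (f j) = if blockTTTV i = blockTTTV j then 2 else 1

/-- The set of cliques under study. -/
def X : Set (Finset Exc) := {S : Finset Exc | S.card = 10 ∧ IsClique {1, 2} S ∧
      HasWeight2Graph (fun i j => blockTTTV i = blockTTTV j) S}

theorem PP_inj {f : Fin 10 → Exc} (h : PP f) : Function.Injective f := by
  intro i j hij
  by_contra hne
  have := h i j hne
  rw [hij, Bx_self] at this
  split_ifs at this

theorem mem_X (S : Finset Exc) : S ∈ X ↔ ∃ f, PP f ∧ Finset.univ.image f = S := by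
  constructor
  · rintro ⟨h1, h2, σ, h3⟩
    refine ⟨fun i => (σ i).1, fun i j hij => ?_, ?_⟩
    · have h4 := h3 i j hij
      have h5 := h2 _ (σ i).2 _ (σ j).2 (fun h => hij (σ.injective (Subtype.ext h)))
      simp only [Set.mem_insert_iff, Set.mem_singleton_iff] at h5
      split_ifs with hb
      · exact h4.2 hb
      · exact h5.resolve_right (fun h => hb (h4.1 h))
    · ext x
      simp only [Finset.mem_image, Finset.mem_univ, true_and]
      constructor
      · rintro ⟨i, rfl⟩; exact (σ i).2
      · intro hx; exact ⟨σ.symm ⟨x, hx⟩, by simp⟩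
  · rintro ⟨f, hf, rfl⟩
    have hi := PP_inj hf
    refine ⟨by rw [Finset.card_image_of_injective _ hi]; simp, ?_, ?_⟩
    · intro x hx y hy hxy
      simp only [Finset.mem_image, Finset.mem_univ, true_and] at hx hy
      obtain ⟨i, rfl⟩ := hx
      obtain ⟨j, rfl⟩ := hy
      rw [hf i j (fun h => hxy (by rw [h]))]
      split_ifs <;> simp
    · refine ⟨Equiv.ofBijective (fun i => ⟨f i, Finset.mem_image_of_mem _ (Finset.mem_univ _)⟩) ⟨?_, ?_⟩, ?_⟩
      · intro i j h
        exact hi (congrArg Subtype.val h)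
      · rintro ⟨x, hx⟩
        obtain ⟨i, -, rfl⟩ := Finset.mem_image.1 hx
        exact ⟨i, rfl⟩
      · intro i j hij
        show Bx (f i) (f j) = 2 ↔ blockTTTV i = blockTTTV j
        rw [hf i j hij]
        split_ifs with hb <;> simp [hb]

theorem PP_smul {g : Equiv.Perm Exc} (hg : g ∈ W) {f : Fin 10 → Exc} (h : PP f) :
    PP (fun i => g (f i)) := fun i j hij => by rw [W_Bx hg]; exact h i j hij

def sf (i : Fin 10) : Exc := s i.1

theorem PP_check : ∀ i j : Fin 10, i ≠ j → eqB (vv (sn i.1)) (vv (sn j.1))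
    (if blockTTTV i = blockTTTV j then 3 else 2) = true := by decide +kernel

theorem PP_sf : PP sf := by
  intro i j hij
  have := PP_check i j hij
  rw [← toV_s, ← toV_s, eqB_iff] at this
  rw [sf, sf, this]
  split_ifs <;> norm_num

def SS : Finset Exc := Finset.univ.image sf

theorem SS_card : SS.card = 10 := by
  rw [SS, Finset.card_image_of_injective _ (PP_inj PP_sf)]; simp

theorem mem_SS (x : Exc) : x ∈ SS ↔ ∃ j < 10, x = s j := by
  simp only [SS, Finset.mem_image, Finset.mem_univ, true_and, sf]
  exact ⟨fun ⟨i, h⟩ => ⟨i.1, i.2, h.symm⟩, fun ⟨j, hj, h⟩ => ⟨⟨j, hj⟩, h.symm⟩⟩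

theorem s_mem (j : ℕ) (hj : j < 10) : s j ∈ SS := (mem_SS _).2 ⟨j, hj, rfl⟩

theorem t0 : t 0 = s 0 := rfl
theorem t1 : t 1 = s 1 := rfl
theorem t2 : t 2 = s 3 := rfl
theorem t3 : t 3 = s 4 := rfl

theorem chk2 : L240.all (fun v => !(eqB v (vv (sn 0)) 3 && eqB v (vv (sn 1)) 3) ||
    decide (v = vv (sn 2))) = true := by decide +kernel

theorem chk5 : L240.all (fun v => !(eqB v (vv (sn 3)) 3 && eqB v (vv (sn 4)) 3) ||
    decide (v = vv (sn 5))) = true := by decide +kernel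

theorem chkO : L240.all (fun v => !(eqB v (vv (sn 0)) 2 && eqB v (vv (sn 1)) 2 &&
    eqB v (vv (sn 3)) 2 && eqB v (vv (sn 4)) 2) ||
    oIdx.any (fun i => decide (v = vv i))) = true := by decide +kernel

theorem chkR : oIdx.all (fun i => oIdx.all (fun j => !(eqB (vv i) (vv j) 3) ||
    oIdx.all (fun k => !(eqB (vv i) (vv k) 3 && eqB (vv j) (vv k) 3) ||
    oIdx.all (fun l => !(eqB (vv i) (vv l) 2 && eqB (vv j) (vv l) 2 && eqB (vv k) (vv l) 2) ||
      rowsX.any (fun r => [i, j, k, l, sn 0, sn 1, sn 2, sn 3, sn 4, sn 5].all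
        (fun m => (List.range 10).any (fun n => r.2.getD n 0 == m))))))) = true := by
  decide +kernel

theorem of_chk {p q : V → Bool} (h : L240.all (fun v => !(p v) || q v) = true) (x : Exc)
    (hp : p (toV x) = true) : q (toV x) = true := by
  rw [List.all_eq_true] at h
  have := h _ (mem_L x)
  rw [hp] at this
  simpa using this

theorem ofO (x : Exc) (h0 : Bx x (s 0) = 1) (h1 : Bx x (s 1) = 1) (h3 : Bx x (s 3) = 1)
    (h4 : Bx x (s 4) = 1) : ∃ i ∈ oIdx, x = ex i := by
  have := of_chk chkO x (by
    simp only [← toV_s, Bool.and_eq_true, eqB_iff, h0, h1, h3, h4]; norm_num)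
  simp only [List.any_eq_true, decide_eq_true_eq, ← toV_ex] at this
  obtain ⟨i, hi, h⟩ := this
  exact ⟨i, hi, toV_inj h⟩

theorem row_mem {r : List ℕ × List ℕ} (h : r ∈ rowsX ++ rowsS) :
    ∃ g ∈ W, ∀ j < 10, g (s j) = ex (r.2.getD j 0) :=
  row r.1 r.2 (List.all_eq_true.1 rows_check r h)

theorem trans0 (x : Fin 10 → Exc) (hx : PP x) (h0 : x 0 = s 0) (h1 : x 1 = s 1) (h3 : x 3 = s 3)
    (h4 : x 4 = s 4) : ∃ g ∈ W, Finset.univ.image x = SS.image g := by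
  have h2 : x 2 = s 2 := by
    have := of_chk chk2 (x 2) (by
      simp only [← toV_s, Bool.and_eq_true, eqB_iff, ← h0, ← h1]
      rw [hx 2 0 (by decide), hx 2 1 (by decide)]; decide)
    simp only [decide_eq_true_eq, ← toV_s] at this
    exact toV_inj this
  have h5 : x 5 = s 5 := by
    have := of_chk chk5 (x 5) (by
      simp only [← toV_s, Bool.and_eq_true, eqB_iff, ← h3, ← h4]
      rw [hx 5 3 (by decide), hx 5 4 (by decide)]; decide)
    simp only [decide_eq_true_eq, ← toV_s] at this
    exact toV_inj this
  have hO : ∀ i : Fin 10, 6 ≤ i → ∃ k ∈ oIdx, x i = ex k := by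
    intro i hi
    apply ofO
    · rw [← h0, hx i 0 (by rintro rfl; revert hi; decide)]; revert i; decide
    · rw [← h1, hx i 1 (by rintro rfl; revert hi; decide)]; revert i; decide
    · rw [← h3, hx i 3 (by rintro rfl; revert hi; decide)]; revert i; decide
    · rw [← h4, hx i 4 (by rintro rfl; revert hi; decide)]; revert i; decide
  obtain ⟨i, hi, e6⟩ := hO 6 (by decide)
  obtain ⟨j, hj, e7⟩ := hO 7 (by decide)
  obtain ⟨k, hk, e8⟩ := hO 8 (by decide)
  obtain ⟨l, hl, e9⟩ := hO 9 (by decide)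
  have k1 : eqB (vv i) (vv j) 3 = true := by
    rw [← toV_ex, ← toV_ex, eqB_iff, ← e6, ← e7, hx 6 7 (by decide)]; decide
  have k2 : eqB (vv i) (vv k) 3 = true := by
    rw [← toV_ex, ← toV_ex, eqB_iff, ← e6, ← e8, hx 6 8 (by decide)]; decide
  have k3 : eqB (vv j) (vv k) 3 = true := by
    rw [← toV_ex, ← toV_ex, eqB_iff, ← e7, ← e8, hx 7 8 (by decide)]; decide
  have k4 : eqB (vv i) (vv l) 2 = true := by
    rw [← toV_ex, ← toV_ex, eqB_iff, ← e6, ← e9, hx 6 9 (by decide)]; decide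
  have k5 : eqB (vv j) (vv l) 2 = true := by
    rw [← toV_ex, ← toV_ex, eqB_iff, ← e7, ← e9, hx 7 9 (by decide)]; decide
  have k6 : eqB (vv k) (vv l) 2 = true := by
    rw [← toV_ex, ← toV_ex, eqB_iff, ← e8, ← e9, hx 8 9 (by decide)]; decide
  have c := List.all_eq_true.1 (List.all_eq_true.1 chkR i hi) j hj
  rw [k1, Bool.not_true, Bool.false_or] at c
  have c := List.all_eq_true.1 c k hk
  rw [k2, k3, Bool.and_self, Bool.not_true, Bool.false_or] at c
  have c := List.all_eq_true.1 c l hl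
  rw [k4, k5, k6, Bool.and_self, Bool.and_self, Bool.not_true, Bool.false_or] at c
  obtain ⟨r, hr, c⟩ := List.any_eq_true.1 c
  obtain ⟨g, hg, hgs⟩ := row_mem (List.mem_append_left _ hr)
  have key : ∀ m ∈ [i, j, k, l, sn 0, sn 1, sn 2, sn 3, sn 4, sn 5], ex m ∈ SS.image g := by
    intro m hm
    have c := List.all_eq_true.1 c m hm
    simp only [List.any_eq_true, List.mem_range, beq_iff_eq] at c
    obtain ⟨n, hn, c⟩ := c
    rw [← c, ← hgs n hn]
    exact Finset.mem_image_of_mem _ (s_mem n hn)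
  refine ⟨g, hg, Finset.eq_of_subset_of_card_le ?_ ?_⟩
  · intro y hy
    obtain ⟨n, -, rfl⟩ := Finset.mem_image.1 hy
    fin_cases n
    · exact h0 ▸ key (sn 0) (by simp)
    · exact h1 ▸ key (sn 1) (by simp)
    · exact h2 ▸ key (sn 2) (by simp)
    · exact h3 ▸ key (sn 3) (by simp)
    · exact h4 ▸ key (sn 4) (by simp)
    · exact h5 ▸ key (sn 5) (by simp)
    · exact e6 ▸ key i (by simp)
    · exact e7 ▸ key j (by simp)
    · exact e8 ▸ key k (by simp)
    · exact e9 ▸ key l (by simp)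
  · rw [Finset.card_image_of_injective _ g.injective, SS_card,
      Finset.card_image_of_injective _ (PP_inj hx)]; simp

theorem trans1 (S : Finset Exc) (hS : S ∈ X) : ∃ g ∈ W, SS.image g = S := by
  obtain ⟨f, hf, rfl⟩ := (mem_X S).1 hS
  obtain ⟨g, hg, hgt⟩ := transW (fun i => if i = 0 then f 0 else if i = 1 then f 1 else
    if i = 2 then f 3 else f 4) 4 (by norm_num) (by
      have hs := PP_sf
      intro i hi j hj
      interval_cases i <;> interval_cases j
      · exact (hf 1 0 (by decide)).trans (hs 1 0 (by decide)).symm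
      · exact (hf 3 0 (by decide)).trans (hs 3 0 (by decide)).symm
      · exact (hf 3 1 (by decide)).trans (hs 3 1 (by decide)).symm
      · exact (hf 4 0 (by decide)).trans (hs 4 0 (by decide)).symm
      · exact (hf 4 1 (by decide)).trans (hs 4 1 (by decide)).symm
      · exact (hf 4 3 (by decide)).trans (hs 4 3 (by decide)).symm)
  have hi : ∀ x y, g x = y → g⁻¹ y = x := by
    rintro x y rfl; simp
  obtain ⟨h, hh, he⟩ := trans0 (fun i => g⁻¹ (f i)) (PP_smul (W.inv_mem hg) hf)
    (hi _ _ (hgt 0 (by norm_num))) (hi _ _ (hgt 1 (by norm_num)))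
    (hi _ _ (hgt 2 (by norm_num))) (hi _ _ (hgt 3 (by norm_num)))
  refine ⟨g * h, W.mul_mem hg hh, ?_⟩
  have : SS.image (g * h : Equiv.Perm Exc) = (SS.image h).image g := by
    rw [Finset.image_image]; rfl
  rw [this, ← he, Finset.image_image]
  congr 1
  funext i
  exact app_inv g _

theorem smul_X {g : Equiv.Perm Exc} (hg : g ∈ W) {S : Finset Exc} (hS : S ∈ X) : S.image g ∈ X := by
  obtain ⟨f, hf, rfl⟩ := (mem_X S).1 hS
  rw [mem_X]
  exact ⟨_, PP_smul hg hf, by rw [Finset.image_image]; rfl⟩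

theorem SS_X : SS ∈ X := (mem_X _).2 ⟨sf, PP_sf, rfl⟩

open scoped Pointwise in
theorem orb (S : Finset Exc) (hS : S ∈ X) : {T | ∃ g ∈ W, g • S = T} = X := by
  ext T
  simp only [Set.mem_ofPred_eq, smul_eq_image]
  constructor
  · rintro ⟨g, hg, rfl⟩; exact smul_X hg hS
  · intro hT
    obtain ⟨g, hg, rfl⟩ := trans1 S hS
    obtain ⟨h, hh, rfl⟩ := trans1 T hT
    refine ⟨h * g⁻¹, W.mul_mem hh (W.inv_mem hg), ?_⟩
    rw [Finset.image_image]
    congr 1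
    funext x
    simp

open scoped Pointwise in
theorem card_stab (S : Finset Exc) : {g : Exc ≃ Exc | PreservesB g ∧ S.image g = S}.ncard =
    Nat.card (W ⊓ MulAction.stabilizer (Equiv.Perm Exc) S : Subgroup (Equiv.Perm Exc)) := rfl

open scoped Pointwise in
theorem main_count (S : Finset Exc) (hS : S ∈ X) :
    696729600 = X.ncard * {g : Exc ≃ Exc | PreservesB g ∧ S.image g = S}.ncard := by
  rw [card_stab, ← card_W, card_step W S, orb S hS]

open scoped Pointwise in
def fixP : List ℕ → Subgroup (Equiv.Perm Exc)
  | [] => W ⊓ MulAction.stabilizer (Equiv.Perm Exc) SS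
  | k :: l => fixP l ⊓ MulAction.stabilizer (Equiv.Perm Exc) (s k)

theorem mem_fixP (l : List ℕ) (g : Equiv.Perm Exc) :
    g ∈ fixP l ↔ (g ∈ W ∧ SS.image g = SS) ∧ ∀ k ∈ l, g (s k) = s k := by
  induction l with
  | nil =>
    simp only [List.not_mem_nil, false_imp_iff, implies_true, and_true]
    exact Iff.rfl
  | cons k l ih =>
    rw [fixP, Subgroup.mem_inf, ih, MulAction.mem_stabilizer_iff, Equiv.Perm.smul_def,
      List.forall_mem_cons]
    tauto

def inJ (J : List ℕ) (v : V) : Bool := J.any (fun j => decide (v = vv (sn j)))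

def rowY (q : ℕ) : List ℕ := (rowsS.getD q ([], [])).2

theorem rowY_check : (List.range 20).all (fun q => (List.range 10).all (fun j =>
    sIdx.contains ((rowY q).getD j 0))) = true := by decide +kernel

theorem s_all : sIdx.all (fun i => (List.range 10).any (fun j => sn j == i)) = true := by
  decide +kernel

theorem rowsS_len : rowsS.length = 20 := by decide +kernel

theorem rowS (q : ℕ) (hq : q < 20) : ∃ g : Equiv.Perm Exc, (g ∈ W ∧ SS.image g = SS) ∧
    ∀ j < 10, g (s j) = ex ((rowY q).getD j 0) := by
  have hq2 : q < rowsS.length := by rw [rowsS_len]; exact hq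
  have hm : rowsS.getD q ([], []) ∈ rowsX ++ rowsS := by
    apply List.mem_append_right
    rw [List.getD_eq_getElem _ _ hq2]
    exact List.getElem_mem _
  obtain ⟨g, hg, h⟩ := row_mem hm
  refine ⟨g, ⟨hg, ?_⟩, h⟩
  apply Finset.eq_of_subset_of_card_le
  · intro y hy
    obtain ⟨x, hx, rfl⟩ := Finset.mem_image.1 hy
    obtain ⟨j, hj, rfl⟩ := (mem_SS x).1 hx
    rw [h j hj]
    have c := List.all_eq_true.1 (List.all_eq_true.1 rowY_check q (List.mem_range.2 hq)) j
      (List.mem_range.2 hj)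
    rw [List.contains_iff_mem] at c
    have c2 := List.all_eq_true.1 s_all _ c
    simp only [List.any_eq_true, List.mem_range, beq_iff_eq] at c2
    obtain ⟨i, hi, e⟩ := c2
    have e' : sn i = (rowsS.getD q ([], [])).2.getD j 0 := e
    rw [← e']
    exact s_mem i hi
  · rw [Finset.card_image_of_injective _ g.injective]

theorem fix_step (l : List ℕ) (k : ℕ) (J : List ℕ) (n : ℕ) (hk : k < 10) (hl : ∀ i ∈ l, i < 10)
    (hn : (L240.filter (inJ J)).length = n)
    (hsub : ∀ g ∈ fixP l, ∃ j ∈ J, g (s k) = s j)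
    (hsup : ∀ j ∈ J, ∃ q < 20, (rowY q).getD k 0 = sn j ∧ ∀ i ∈ l, (rowY q).getD i 0 = sn i) :
    Nat.card (fixP l) = n * Nat.card (fixP (k :: l)) := by
  rw [card_step (fixP l) (s k), ← hn, ← ncard_toV]
  congr 2
  ext y
  simp only [Set.mem_ofPred_eq, Equiv.Perm.smul_def, inJ, List.any_eq_true, decide_eq_true_eq,
    ← toV_s]
  constructor
  · rintro ⟨g, hg, rfl⟩
    obtain ⟨j, hj, e⟩ := hsub g hg
    exact ⟨j, hj, by rw [e]⟩
  · rintro ⟨j, hj, e⟩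
    obtain ⟨q, hq, h1, h2⟩ := hsup j hj
    obtain ⟨g, hg, h3⟩ := rowS q hq
    refine ⟨g, (mem_fixP _ _).2 ⟨hg, fun i hi => ?_⟩, ?_⟩
    · rw [h3 i (hl i hi), h2 i hi]; rfl
    · rw [h3 k hk, h1, toV_inj e]; rfl

/-- weight two -/
def mm (i j : ℕ) : Bool := eqB (vv (sn i)) (vv (sn j)) 3

theorem mm_pres {g : Equiv.Perm Exc} (hg : g ∈ W) {i i' j j' : ℕ} (hi : g (s i) = s i')
    (hj : g (s j) = s j') : mm i' j' = mm i j := by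
  rw [Bool.eq_iff_iff, mm, mm, ← toV_s, ← toV_s, ← toV_s, ← toV_s, eqB_iff, eqB_iff, ← hi, ← hj,
    W_Bx hg]

theorem img {g : Equiv.Perm Exc} (h : SS.image g = SS) (i : ℕ) (hi : i < 10) :
    ∃ j < 10, g (s i) = s j := by
  rw [← mem_SS]
  have := Finset.mem_image_of_mem g (s_mem i hi)
  rwa [h] at this

theorem sub0 (g) (hg : g ∈ fixP []) : ∃ j ∈ [0, 1, 2, 3, 4, 5, 6, 7, 8], g (s 0) = s j := by
  rw [mem_fixP] at hg
  obtain ⟨⟨hW, hS⟩, -⟩ := hg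
  obtain ⟨j, hj, e⟩ := img hS 0 (by norm_num)
  obtain ⟨j', hj', e'⟩ := img hS 1 (by norm_num)
  have c : ∀ j < 10, ∀ j' < 10, mm j j' = mm 0 1 → j ∈ [0, 1, 2, 3, 4, 5, 6, 7, 8] := by
    decide +kernel
  exact ⟨j, c j hj j' hj' (mm_pres hW e e'), e⟩

theorem sub1 (g) (hg : g ∈ fixP [0]) : ∃ j ∈ [1, 2], g (s 1) = s j := by
  rw [mem_fixP] at hg
  obtain ⟨⟨hW, hS⟩, hf⟩ := hg
  have f0 := hf 0 (by simp)
  obtain ⟨j, hj, e⟩ := img hS 1 (by norm_num)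
  have c : ∀ j < 10, mm j 0 = mm 1 0 → j ∈ [1, 2] := by decide +kernel
  exact ⟨j, c j hj (mm_pres hW e f0), e⟩

theorem sub3 (g) (hg : g ∈ fixP [1, 0]) : ∃ j ∈ [3, 4, 5, 6, 7, 8], g (s 3) = s j := by
  rw [mem_fixP] at hg
  obtain ⟨⟨hW, hS⟩, hf⟩ := hg
  have f0 := hf 0 (by simp)
  have f1 := hf 1 (by simp)
  obtain ⟨j, hj, e⟩ := img hS 3 (by norm_num)
  obtain ⟨j', hj', e'⟩ := img hS 4 (by norm_num)
  have c : ∀ j < 10, ∀ j' < 10, mm j 0 = mm 3 0 ∧ mm j 1 = mm 3 1 ∧ mm j j' = mm 3 4 →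
      j ∈ [3, 4, 5, 6, 7, 8] := by decide +kernel
  exact ⟨j, c j hj j' hj' ⟨mm_pres hW e f0, mm_pres hW e f1, mm_pres hW e e'⟩, e⟩

/-- `v` pairs with `s i` as `t k` does with `s j` -/
def pr (v : V) (i k j : ℕ) : Bool := sameB v (vv (sn i)) (vv (tn k)) (vv (sn j))

theorem pr_pres {g : Equiv.Perm Exc} (hg : g ∈ W) {i j : ℕ} (k : ℕ) (hj : g (s j) = s i) :
    pr (toV (g (t k))) i k j = true := by
  rw [pr, ← toV_s, ← toV_s, ← toV_t, sameB_iff, ← hj, W_Bx hg]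

theorem chk4 : (List.range 10).all (fun j => (List.range 10).all (fun i => (List.range 10).all (fun k =>
    !(mm j 0 == mm 4 0 && mm j 1 == mm 4 1 && mm j 3 == mm 4 3 && mm i k == mm 6 7 &&
      mm i 0 == mm 6 0 && mm i 1 == mm 6 1 && mm i 3 == mm 6 3 && mm i j == mm 6 4) || (j == 4 ||
      L240.all (fun v => !(pr v 0 4 0 && pr v 1 4 1 && pr v 3 4 3 && pr v j 4 4 && pr v i 4 6)))))) =
    true := by decide +kernel

theorem sub4 (g) (hg : g ∈ fixP [3, 1, 0]) : ∃ j ∈ [4], g (s 4) = s j := by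
  rw [mem_fixP] at hg
  obtain ⟨⟨hW, hS⟩, hf⟩ := hg
  have f0 := hf 0 (by simp)
  have f1 := hf 1 (by simp)
  have f3 := hf 3 (by simp)
  obtain ⟨j, hj, e⟩ := img hS 4 (by norm_num)
  obtain ⟨i, hi, e6⟩ := img hS 6 (by norm_num)
  obtain ⟨k, hk, e7⟩ := img hS 7 (by norm_num)
  have c := List.all_eq_true.1 (List.all_eq_true.1 (List.all_eq_true.1 chk4 j (List.mem_range.2 hj))
    i (List.mem_range.2 hi)) k (List.mem_range.2 hk)
  rw [mm_pres hW e f0, mm_pres hW e f1, mm_pres hW e f3, mm_pres hW e6 e7, mm_pres hW e6 f0,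
    mm_pres hW e6 f1, mm_pres hW e6 f3, mm_pres hW e6 e] at c
  simp only [beq_self_eq_true, Bool.and_self, Bool.not_true, Bool.false_or, Bool.or_eq_true,
    beq_iff_eq] at c
  rcases c with rfl | c
  · exact ⟨4, by simp, e⟩
  · have c := List.all_eq_true.1 c _ (mem_L (g (t 4)))
    rw [pr_pres hW 4 f0, pr_pres hW 4 f1, pr_pres hW 4 f3, pr_pres hW 4 e, pr_pres hW 4 e6] at c
    exact absurd c (by decide)

theorem sub6 (g) (hg : g ∈ fixP [4, 3, 1, 0]) : ∃ j ∈ [6, 7, 8], g (s 6) = s j := by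
  rw [mem_fixP] at hg
  obtain ⟨⟨hW, hS⟩, hf⟩ := hg
  have f0 := hf 0 (by simp)
  have f1 := hf 1 (by simp)
  have f3 := hf 3 (by simp)
  have f4 := hf 4 (by simp)
  obtain ⟨j, hj, e⟩ := img hS 6 (by norm_num)
  obtain ⟨j', hj', e'⟩ := img hS 7 (by norm_num)
  have c : ∀ j < 10, ∀ j' < 10, mm j 0 = mm 6 0 ∧ mm j 1 = mm 6 1 ∧ mm j 3 = mm 6 3 ∧
      mm j 4 = mm 6 4 ∧ mm j j' = mm 6 7 → j ∈ [6, 7, 8] := by decide +kernel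
  exact ⟨j, c j hj j' hj' ⟨mm_pres hW e f0, mm_pres hW e f1, mm_pres hW e f3,
    mm_pres hW e f4, mm_pres hW e e'⟩, e⟩

theorem chkT : (List.range 8).all (fun k => L240.all (fun v => !(pr v 0 k 0 && pr v 1 k 1 &&
    pr v 3 k 3 && pr v 4 k 4 && pr v 6 k 6 && pr v 9 k 9) || decide (v = vv (tn k)))) = true := by
  decide +kernel

theorem chk9 : ∀ j < 10, eqB (vv (sn j)) (vv (sn 0)) 2 = true ∧ eqB (vv (sn j)) (vv (sn 1)) 2 = true ∧
    eqB (vv (sn j)) (vv (sn 3)) 2 = true ∧ eqB (vv (sn j)) (vv (sn 4)) 2 = true ∧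
    eqB (vv (sn j)) (vv (sn 6)) 2 = true → j = 9 := by decide +kernel

theorem fix_end : fixP [6, 4, 3, 1, 0] = ⊥ := by
  rw [Subgroup.eq_bot_iff_forall]
  intro g hg
  rw [mem_fixP] at hg
  obtain ⟨⟨hW, hS⟩, hf⟩ := hg
  have f0 := hf 0 (by simp)
  have f1 := hf 1 (by simp)
  have f3 := hf 3 (by simp)
  have f4 := hf 4 (by simp)
  have f6 := hf 6 (by simp)
  obtain ⟨j, hj, e⟩ := img hS 9 (by norm_num)
  have aux : ∀ i : Fin 10, i ≠ 9 → g (s i.1) = s i.1 → eqB (vv (sn j)) (vv (sn i.1)) 2 = true := by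
    intro i hi hfi
    rw [← toV_s, ← toV_s, eqB_iff, ← e, ← hfi, W_Bx hW]
    refine (PP_sf 9 i hi.symm).trans ?_
    clear hfi
    revert i
    clear e hj f0 f1 f3 f4 f6 hf hS hW
    clear g j
    decide
  have h9 : j = 9 := chk9 j hj ⟨aux 0 (by decide) f0, aux 1 (by decide) f1, aux 3 (by decide) f3,
    aux 4 (by decide) f4, aux 6 (by decide) f6⟩
  subst h9
  rw [← Subgroup.mem_bot, ← H8, mem_H]
  refine ⟨hW, fun k hk => ?_⟩
  have := of_chk (List.all_eq_true.1 chkT k (List.mem_range.2 hk)) (g (t k)) (by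
    simp only [pr_pres hW k f0, pr_pres hW k f1, pr_pres hW k f3, pr_pres hW k f4, pr_pres hW k f6,
      pr_pres hW k e, Bool.and_self])
  rw [decide_eq_true_eq, ← toV_t] at this
  exact toV_inj this

theorem card_SS : {g : Exc ≃ Exc | PreservesB g ∧ SS.image g = SS}.ncard = 324 := by
  rw [card_stab]
  change Nat.card (fixP []) = 324
  rw [fix_step [] 0 [0, 1, 2, 3, 4, 5, 6, 7, 8] 9 (by decide) (by decide) (by decide +kernel) sub0
      (by decide +kernel),
    fix_step [0] 1 [1, 2] 2 (by decide) (by decide) (by decide +kernel) sub1 (by decide +kernel),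
    fix_step [1, 0] 3 [3, 4, 5, 6, 7, 8] 6 (by decide) (by decide) (by decide +kernel) sub3
      (by decide +kernel),
    fix_step [3, 1, 0] 4 [4] 1 (by decide) (by decide) (by decide +kernel) sub4 (by decide +kernel),
    fix_step [4, 3, 1, 0] 6 [6, 7, 8] 3 (by decide) (by decide) (by decide +kernel) sub6
      (by decide +kernel), fix_end]
  simp

theorem X_card : X.ncard = 2150400 := by
  have := main_count SS SS_X
  rw [card_SS] at this
  omega


/-- There are exactly 2,150,400 ten-element cliques in `C` with weights in `{1,2}` whose
weight-2 graph is three triangles plus an isolated vertex, and the stabilizer in `W` of any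
such clique has order 324. -/
theorem stmt13 :
    {S : Finset Exc | S.card = 10 ∧ IsClique {1, 2} S ∧
      HasWeight2Graph (fun i j => blockTTTV i = blockTTTV j) S}.ncard = 2150400 ∧
    ∀ S : Finset Exc, S.card = 10 → IsClique {1, 2} S →
      HasWeight2Graph (fun i j => blockTTTV i = blockTTTV j) S →
      {g : Exc ≃ Exc | PreservesB g ∧ S.image g = S}.ncard = 324 := by

  refine ⟨X_card, fun S h1 h2 h3 => ?_⟩
  have := main_count S ⟨h1, h2, h3⟩
  rw [X_card] at this
  omega
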